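/- Let l ≥ 2 be an integer and let {m_k} be any enumeration (not necessarily increasing) of the set D*(l). Then for complex coefficients {c_k}, the series ∑_k c_k e^{2πi m_k x} converges for almost every x ∈ (0,1) if and only if ∑_k |c_k|² < ∞. -/

import Mathlib

open MeasureTheory Filter Finset Topology

noncomputable section

/-- The exponential `e^{2πimx}`. -/
def expi (m : ℤ) (x : ℝ) : ℂ := Complex.exp (2 * Real.pi * Complex.I * m * x)

/-- `D(s)`: positive integers `m = 2^{k₁} + ⋯ + 2^{k_s}` with `k₁ > ⋯ > k_s ≥ 1`. -/
def DyadicSums (s : ℕ) : Set ℕ :=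
  {m | ∃ k : Fin s → ℕ, StrictAnti k ∧ (∀ j, 1 ≤ k j) ∧ m = ∑ j, 2 ^ (k j)}

/-- `D*(l) = ⋃_{1 ≤ s ≤ l} D(s)`. -/
def DyadicStar (l : ℕ) : Set ℕ := ⋃ s ∈ Set.Icc 1 l, DyadicSums s


/-- Tuples of exponents with prescribed sum of powers of two: boundedly many. -/
lemma count_tuples (t : ℕ) : ∃ C : ℕ, ∀ n : ℕ, ∃ F : Finset (Fin t → ℕ), F.card ≤ C ∧
    ∀ f : Fin t → ℕ, ∑ i, 2 ^ f i = n → f ∈ F := by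
  classical
  induction t with
  | zero => exact ⟨1, fun n => ⟨Finset.univ, by simp, fun f _ => Finset.mem_univ f⟩⟩
  | succ t ih =>
    obtain ⟨C, hC⟩ := ih
    choose F hF1 hF2 using hC
    refine ⟨(t + 1) * ((t + 2) * C), fun n => ⟨(Finset.univ : Finset (Fin (t+1))).biUnion fun i =>
      (Finset.Icc (Nat.log 2 n - (t+1)) (Nat.log 2 n)).biUnion fun v =>
        (F (n - 2 ^ v)).image (fun g => (i.insertNth v g : Fin (t+1) → ℕ)), ?_, ?_⟩⟩
    · refine (Finset.card_biUnion_le_card_mul _ _ ((t+2) * C) fun i _ => ?_).trans (by simp)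
      refine (Finset.card_biUnion_le_card_mul _ _ C fun v _ => ?_).trans ?_
      · exact Finset.card_image_le.trans (hF1 _)
      · gcongr
        rw [Nat.card_Icc]; omega
    · intro f hf
      obtain ⟨i, -, hi⟩ := Finset.exists_max_image (Finset.univ : Finset (Fin (t+1))) f
        ⟨0, Finset.mem_univ _⟩
      simp only [Finset.mem_biUnion, Finset.mem_image, Finset.mem_univ, true_and]
      have h1 : 2 ^ f i ≤ n := by
        rw [← hf]
        exact Finset.single_le_sum (f := fun i => 2 ^ f i) (fun _ _ => Nat.zero_le _)
          (Finset.mem_univ i)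
      have hn0 : n ≠ 0 := by
        have : 0 < 2 ^ f i := by positivity
        omega
      have h2 : n < 2 ^ (t + 1 + f i) := by
        have : n ≤ (t + 1) * 2 ^ f i := by
          rw [← hf]
          refine (Finset.sum_le_card_nsmul _ _ (2 ^ f i) fun j hj => ?_).trans (by simp)
          exact Nat.pow_le_pow_right (by norm_num) (hi j hj)
        rw [pow_add]
        refine this.trans_lt ?_
        exact Nat.mul_lt_mul_of_pos_right (Nat.lt_two_pow_self) (by positivity)
      refine ⟨i, f i, ?_, fun j => f (i.succAbove j), ?_, ?_⟩
      · rw [Finset.mem_Icc]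
        have := Nat.log_lt_of_lt_pow hn0 h2
        have := Nat.le_log_of_pow_le (by norm_num) h1
        omega
      · apply hF2
        rw [Fin.sum_univ_succAbove _ i] at hf
        omega
      · exact Fin.insertNth_self_removeNth i f

lemma count_pairs (l : ℕ) : ∃ C : ℕ, ∀ n : ℕ, ∃ F : Finset ℕ, F.card ≤ C ∧
    ∀ a b : ℕ, a ∈ DyadicStar l → b ∈ DyadicStar l → a + b = n → a ∈ F := by
  classical
  choose C F hF1 hF2 using count_tuples
  refine ⟨∑ p ∈ Finset.range (l+1) ×ˢ Finset.range (l+1), C (p.1 + p.2), fun n =>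
    ⟨(Finset.range (l+1) ×ˢ Finset.range (l+1)).biUnion fun p =>
      (F (p.1 + p.2) n).image fun f => ∑ i : Fin p.1, 2 ^ f (Fin.castAdd p.2 i), ?_, ?_⟩⟩
  · refine Finset.card_biUnion_le.trans (Finset.sum_le_sum fun p _ => ?_)
    exact Finset.card_image_le.trans (hF1 _ _)
  · intro a b ha hb hab
    simp only [DyadicStar, Set.mem_iUnion, DyadicSums, Set.mem_ofPred_eq] at ha hb
    obtain ⟨s, hs, k, -, -, rfl⟩ := ha
    obtain ⟨s', hs', k', -, -, rfl⟩ := hb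
    simp only [Finset.mem_biUnion, Finset.mem_image, Finset.mem_product, Finset.mem_range]
    refine ⟨(s, s'), ⟨by have := hs.2; simp; omega, by have := hs'.2; simp; omega⟩,
      Fin.append k k', ?_, ?_⟩
    · apply hF2
      rw [Fin.sum_univ_add]
      simpa using hab
    · simp

/-- The normalized measure. -/
abbrev muI : Measure ℝ := volume.restrict (Set.Ioo (0:ℝ) 1)

instance : IsProbabilityMeasure muI := ⟨by simp [muI]⟩

lemma integrable_muI {E : Type*} [NormedAddCommGroup E] {g : ℝ → E} (hg : Continuous g) :
    Integrable g muI :=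
  (hg.continuousOn.integrableOn_Icc (a := 0) (b := 1)).mono_set Set.Ioo_subset_Icc_self

lemma continuous_expi (n : ℤ) : Continuous (expi n) := by
  unfold expi; fun_prop

lemma expi_add (a b : ℤ) (x : ℝ) : expi (a + b) x = expi a x * expi b x := by
  unfold expi; rw [← Complex.exp_add]; congr 1; push_cast; ring

lemma conj_expi (a : ℤ) (x : ℝ) : (starRingEnd ℂ) (expi a x) = expi (-a) x := by
  unfold expi; rw [← Complex.exp_conj]; congr 1
  simp only [map_mul, Complex.conj_I, Complex.conj_ofReal, map_intCast, map_ofNat]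
  push_cast; ring

lemma integral_expi (n : ℤ) : ∫ x, expi n x ∂muI = if n = 0 then 1 else 0 := by
  split_ifs with h
  · subst h; simp [expi]
  · rw [muI, ← MeasureTheory.integral_Ioc_eq_integral_Ioo,
      ← intervalIntegral.integral_of_le zero_le_one]
    unfold expi
    have hc : (2 * Real.pi * Complex.I * n : ℂ) ≠ 0 := by
      simp [h, Real.pi_ne_zero]
    rw [integral_exp_mul_complex hc]
    have : Complex.exp (2 * Real.pi * Complex.I * n * (1:ℝ)) = 1 := by
      rw [Complex.exp_eq_one_iff]
      exact ⟨n, by push_cast; ring⟩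
    rw [this]; simp

lemma parseval {ι : Type*} (N : Finset ι) (q : ι → ℕ) (hq : Set.InjOn q N) (d : ι → ℂ) :
    ∫ x, ‖∑ n ∈ N, d n * expi (q n) x‖ ^ 2 ∂muI = ∑ n ∈ N, ‖d n‖ ^ 2 := by
  classical
  have key : ∫ x, ((‖∑ n ∈ N, d n * expi (q n) x‖ ^ 2 : ℝ) : ℂ) ∂muI
      = ((∑ n ∈ N, ‖d n‖ ^ 2 : ℝ) : ℂ) := by
    have h1 : ∀ x, ((‖∑ n ∈ N, d n * expi (q n) x‖ ^ 2 : ℝ) : ℂ)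
        = ∑ a ∈ N, ∑ b ∈ N, (d a * (starRingEnd ℂ) (d b)) * expi ((q a : ℤ) + -(q b : ℤ)) x := by
      intro x
      push_cast
      rw [← Complex.mul_conj', map_sum, Finset.sum_mul_sum]
      refine Finset.sum_congr rfl fun a _ => Finset.sum_congr rfl fun b _ => ?_
      rw [map_mul, conj_expi, expi_add]; ring
    simp_rw [h1]
    have hint : ∀ a b, Integrable (fun x => (d a * (starRingEnd ℂ) (d b)) *
        expi ((q a : ℤ) + -(q b : ℤ)) x) muI := fun a b =>
      integrable_muI ((continuous_expi _).const_mul _)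
    rw [integral_finsetSum _ fun a _ => integrable_finsetSum _ fun b _ => hint a b]
    push_cast
    refine Finset.sum_congr rfl fun a ha => ?_
    rw [integral_finsetSum _ fun b _ => hint a b]
    rw [Finset.sum_eq_single a]
    · rw [integral_const_mul, integral_expi]
      simp [Complex.mul_conj']
    · intro b hb hba
      rw [integral_const_mul, integral_expi, if_neg, mul_zero]
      intro h
      apply hba
      apply hq hb ha
      omega
    · intro h; exact absurd ha h
  rw [integral_complex_ofReal] at key
  exact_mod_cast key

lemma L4_bound (l : ℕ) : ∃ R : ℝ, 1 ≤ R ∧ ∀ (m : ℕ → ℕ), Function.Injective m →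
    (∀ k, m k ∈ DyadicStar l) → ∀ (c : ℕ → ℂ) (F : Finset ℕ),
    ∫ x, ‖∑ k ∈ F, c k * expi (m k) x‖ ^ 4 ∂muI ≤ R * (∑ k ∈ F, ‖c k‖ ^ 2) ^ 2 := by
  classical
  obtain ⟨C, hC⟩ := count_pairs l
  refine ⟨C + 1, by simp, fun m hinj hm c F => ?_⟩
  set P := F ×ˢ F with hP
  set σ : ℕ × ℕ → ℕ := fun p => m p.1 + m p.2 with hσ
  set d : ℕ → ℂ := fun n => ∑ p ∈ P with σ p = n, c p.1 * c p.2 with hd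
  have h1 : ∀ x, ‖∑ k ∈ F, c k * expi (m k) x‖ ^ 4
      = ‖∑ n ∈ P.image σ, d n * expi ((n : ℕ) : ℤ) x‖ ^ 2 := by
    intro x
    rw [show 4 = 2 * 2 from rfl, pow_mul, ← norm_pow]
    congr 2
    rw [pow_two, Finset.sum_mul_sum, ← Finset.sum_product',
      ← Finset.sum_fiberwise_of_maps_to (t := P.image σ) (g := σ)
        (fun p hp => Finset.mem_image_of_mem σ hp)]
    refine Finset.sum_congr rfl fun n _ => ?_
    rw [hd, Finset.sum_mul]
    refine Finset.sum_congr rfl fun p hp => ?_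
    rw [← (Finset.mem_filter.1 hp).2, hσ]
    push_cast
    rw [expi_add]; ring
  simp_rw [h1]
  rw [parseval (P.image σ) (fun n => n) (fun _ _ _ _ h => h) d]
  have h2 : ∀ n, ‖d n‖ ^ 2 ≤ (C + 1) * ∑ p ∈ P with σ p = n, ‖c p.1‖ ^ 2 * ‖c p.2‖ ^ 2 := by
    intro n
    obtain ⟨G, hG1, hG2⟩ := hC n
    have hcard : (P.filter (fun p => σ p = n)).card ≤ C := by
      refine le_trans (Finset.card_le_card_of_injOn (fun p => m p.1) ?_ ?_) hG1
      · intro p hp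
        exact hG2 _ (m p.2) (hm _) (hm _) (Finset.mem_filter.1 hp).2
      · intro p hp p' hp' h
        have e1 := (Finset.mem_filter.1 hp).2
        have e2 := (Finset.mem_filter.1 hp').2
        simp only [hσ] at e1 e2 h
        exact Prod.ext (hinj h) (hinj (by omega))
    calc ‖d n‖ ^ 2 ≤ (∑ p ∈ P with σ p = n, ‖c p.1 * c p.2‖) ^ 2 := by
          gcongr; exact norm_sum_le _ _
      _ ≤ (P.filter (fun p => σ p = n)).card * ∑ p ∈ P with σ p = n, ‖c p.1 * c p.2‖ ^ 2 :=
          sq_sum_le_card_mul_sum_sq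
      _ ≤ (C + 1) * ∑ p ∈ P with σ p = n, ‖c p.1 * c p.2‖ ^ 2 := by
          gcongr
          have : ((P.filter (fun p => σ p = n)).card : ℝ) ≤ C := by exact_mod_cast hcard
          linarith
      _ = _ := by simp_rw [norm_mul, mul_pow]
  calc _ ≤ ∑ n ∈ P.image σ, (C + 1 : ℝ) * ∑ p ∈ P with σ p = n, ‖c p.1‖ ^ 2 * ‖c p.2‖ ^ 2 :=
        Finset.sum_le_sum fun n _ => h2 n
    _ = (C + 1) * (∑ k ∈ F, ‖c k‖ ^ 2) ^ 2 := by
        rw [← Finset.mul_sum, Finset.sum_fiberwise_of_maps_to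
          (fun p hp => Finset.mem_image_of_mem σ hp), pow_two, Finset.sum_mul_sum,
          ← Finset.sum_product']

lemma pow4_ineq (a b : ℝ) (ha : 0 ≤ a) (hb : 0 ≤ b) :
    (a + b) ^ 4 ≤ 1000 * a ^ 4 + 3 / 2 * b ^ 4 := by
  have e1 : (a + b) ^ 2 ≤ 9 * a ^ 2 + 9 / 8 * b ^ 2 := by nlinarith [sq_nonneg (8 * a - b)]
  have e2 : (9 * a ^ 2 + 9 / 8 * b ^ 2) ^ 2 ≤ 1000 * a ^ 4 + 3 / 2 * b ^ 4 := by
    nlinarith [sq_nonneg (10 * a ^ 2 - b ^ 2), sq_nonneg (a ^ 2), sq_nonneg (b ^ 2),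
      sq_nonneg (50 * a ^ 2 - b ^ 2)]
  calc (a + b) ^ 4 = ((a + b) ^ 2) ^ 2 := by ring
    _ ≤ _ := pow_le_pow_left₀ (by positivity) e1 2
    _ ≤ _ := e2

/-- Maximal inequality, with an explicit majorant. -/
lemma maximal (u : ℕ → ℝ → ℂ) (hu : ∀ k, Continuous (u k)) (w : ℕ → ℝ) (hw : ∀ k, 0 ≤ w k)
    (R : ℝ) (hR : 1 ≤ R)
    (hL : ∀ i j, ∫ x, ‖∑ k ∈ Finset.Ico i j, u k x‖ ^ 4 ∂muI ≤ R * (∑ k ∈ Finset.Ico i j, w k) ^ 2)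
    (n : ℕ) : ∀ i j, j - i ≤ n → i ≤ j → ∃ G : ℝ → ℝ, Continuous G ∧ (∀ x, 0 ≤ G x) ∧
      (∀ k, i ≤ k → k ≤ j → ∀ x, ‖∑ r ∈ Finset.Ico i k, u r x‖ ^ 4 ≤ G x) ∧
      ∫ x, G x ∂muI ≤ 4000 * R * (∑ k ∈ Finset.Ico i j, w k) ^ 2 := by
  induction n with
  | zero =>
    intro i j h1 h2
    obtain rfl : i = j := by omega
    refine ⟨fun _ => 0, continuous_const, fun _ => le_rfl, ?_, by simp⟩
    intro k h3 h4 x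
    obtain rfl : i = k := by omega
    simp
  | succ n ih =>
    intro i j h1 h2
    rcases h2.eq_or_lt with rfl | hij
    · exact ih i i (by omega) le_rfl
    set g := ∑ k ∈ Finset.Ico i j, w k with hg
    have g0 : 0 ≤ g := Finset.sum_nonneg fun k _ => hw k
    obtain ⟨p, hip, hpj, hp1, hp2⟩ : ∃ p, i ≤ p ∧ p < j ∧
        ∑ k ∈ Finset.Ico i p, w k ≤ g / 2 ∧ ∑ k ∈ Finset.Ico (p+1) j, w k ≤ g / 2 := by
      classical
      obtain ⟨p, hp, hmax⟩ := Finset.exists_max_image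
        ((Finset.Ico i j).filter fun p => ∑ k ∈ Finset.Ico i p, w k ≤ g / 2) id
        ⟨i, by simp [hij]; linarith⟩
      simp only [Finset.mem_filter, Finset.mem_Ico, id] at hp hmax
      refine ⟨p, hp.1.1, hp.1.2, hp.2, ?_⟩
      rcases Nat.lt_or_ge (p+1) j with h | h
      · have : ¬ (∑ k ∈ Finset.Ico i (p+1), w k ≤ g / 2) := fun h' => by
          have := hmax (p+1) ⟨⟨by omega, h⟩, h'⟩
          omega
        have e := Finset.sum_Ico_consecutive w (show i ≤ p+1 by omega) h.le
        push Not at this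
        linarith
      · rw [Finset.Ico_eq_empty (by omega)]; simp; linarith
    obtain ⟨G1, c1, n1, b1, i1⟩ := ih i p (by omega) hip
    obtain ⟨G2, c2, n2, b2, i2⟩ := ih (p+1) j (by omega) hpj
    have cA : Continuous fun x => ‖∑ r ∈ Finset.Ico i (p+1), u r x‖ ^ 4 := by fun_prop
    refine ⟨fun x => 1000 * ‖∑ r ∈ Finset.Ico i (p+1), u r x‖ ^ 4 + 3 / 2 * (G1 x + G2 x),
      by fun_prop, fun x => ?_, ?_, ?_⟩
    · have := n1 x; have := n2 x; positivity
    · intro k hk1 hk2 x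
      have hn1 := n1 x
      have hn2 := n2 x
      have hA : 0 ≤ ‖∑ r ∈ Finset.Ico i (p+1), u r x‖ ^ 4 := by positivity
      rcases Nat.lt_or_ge p k with h | h
      · rw [← Finset.sum_Ico_consecutive (fun r => u r x) (show i ≤ p+1 by omega) h]
        have hb := b2 k h hk2 x
        calc _ ≤ (‖∑ r ∈ Finset.Ico i (p+1), u r x‖ + ‖∑ r ∈ Finset.Ico (p+1) k, u r x‖) ^ 4 :=
              pow_le_pow_left₀ (norm_nonneg _) (norm_add_le _ _) 4
          _ ≤ _ := pow4_ineq _ _ (norm_nonneg _) (norm_nonneg _)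
          _ ≤ _ := by linarith
      · have hb := b1 k hk1 h x
        linarith
    · have c12 : Continuous fun x => G1 x + G2 x := c1.add c2
      rw [integral_add ((integrable_muI cA).const_mul _)
        ((integrable_muI c12).const_mul _), integral_const_mul,
        integral_const_mul, integral_add (integrable_muI c1) (integrable_muI c2)]
      have hA := hL i (p+1)
      have hs : ∑ k ∈ Finset.Ico i (p+1), w k ≤ g :=
        Finset.sum_le_sum_of_subset_of_nonneg (Finset.Ico_subset_Ico_right hpj) fun k _ _ => hw k
      have q0 : (∑ k ∈ Finset.Ico i (p+1), w k) ^ 2 ≤ g ^ 2 :=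
        pow_le_pow_left₀ (Finset.sum_nonneg fun k _ => hw k) hs 2
      have q1 : (∑ k ∈ Finset.Ico i p, w k) ^ 2 ≤ (g / 2) ^ 2 :=
        pow_le_pow_left₀ (Finset.sum_nonneg fun k _ => hw k) hp1 2
      have q2 : (∑ k ∈ Finset.Ico (p+1) j, w k) ^ 2 ≤ (g / 2) ^ 2 :=
        pow_le_pow_left₀ (Finset.sum_nonneg fun k _ => hw k) hp2 2
      have R0 : 0 ≤ R := by linarith
      have r0 := mul_le_mul_of_nonneg_left q0 R0
      have r1 := mul_le_mul_of_nonneg_left q1 R0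
      have r2 := mul_le_mul_of_nonneg_left q2 R0
      nlinarith

lemma conv_of_summable (u : ℕ → ℝ → ℂ) (hu : ∀ k, Continuous (u k)) (w : ℕ → ℝ)
    (hw : ∀ k, 0 ≤ w k) (R : ℝ) (hR : 1 ≤ R)
    (hL : ∀ i j, ∫ x, ‖∑ k ∈ Finset.Ico i j, u k x‖ ^ 4 ∂muI ≤ R * (∑ k ∈ Finset.Ico i j, w k) ^ 2)
    (hs : Summable w) :
    ∀ᵐ x ∂muI, ∃ L : ℂ, Tendsto (fun N => ∑ k ∈ Finset.range N, u k x) atTop (𝓝 L) := by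
  set tl : ℕ → ℝ := fun n => ∑' k, w (k + n) with htl
  have htl0 : Tendsto tl atTop (𝓝 0) := tendsto_sum_nat_add w
  have hg : ∀ i j, ∑ k ∈ Finset.Ico i j, w k ≤ tl i := by
    intro i j
    rw [Finset.sum_Ico_eq_sum_range]
    simp_rw [add_comm i]
    exact ((summable_nat_add_iff i).2 hs).sum_le_tsum _ fun k _ => hw _
  have hbad : ∀ ε : ℝ, 0 < ε → ∀ n : ℕ,
      muI {x | ∃ k, n ≤ k ∧ ε ≤ ‖∑ r ∈ Finset.Ico n k, u r x‖}
        ≤ ENNReal.ofReal (4000 * R * (tl n) ^ 2 / ε ^ 4) := by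
    intro ε hε n
    have hU : {x | ∃ k, n ≤ k ∧ ε ≤ ‖∑ r ∈ Finset.Ico n k, u r x‖}
        = ⋃ j, {x | ∃ k, n ≤ k ∧ k ≤ j ∧ ε ≤ ‖∑ r ∈ Finset.Ico n k, u r x‖} := by
      ext x
      simp only [Set.mem_ofPred_eq, Set.mem_iUnion]
      exact ⟨fun ⟨k, a, b⟩ => ⟨k, k, a, le_rfl, b⟩, fun ⟨_, k, a, _, b⟩ => ⟨k, a, b⟩⟩
    rw [hU, Monotone.measure_iUnion]
    swap
    · rintro j j' hj x ⟨k, a, b, e⟩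
      exact ⟨k, a, b.trans hj, e⟩
    refine iSup_le fun j => ?_
    rcases Nat.lt_or_ge j n with hjn | hjn
    · have : {x | ∃ k, n ≤ k ∧ k ≤ j ∧ ε ≤ ‖∑ r ∈ Finset.Ico n k, u r x‖} = ∅ := by
        ext x
        simp only [Set.mem_ofPred_eq, Set.mem_empty_iff_false, iff_false]
        rintro ⟨k, a, b, -⟩
        omega
      rw [this]; simp
    obtain ⟨G, cG, nG, bG, iG⟩ := maximal u hu w hw R hR hL (j - n) n j le_rfl hjn
    have hmk := mul_meas_ge_le_integral_of_nonneg (μ := muI) (f := G)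
      (Eventually.of_forall nG) (integrable_muI cG) (ε ^ 4)
    calc muI {x | ∃ k, n ≤ k ∧ k ≤ j ∧ ε ≤ ‖∑ r ∈ Finset.Ico n k, u r x‖}
        ≤ muI {x | ε ^ 4 ≤ G x} := by
          apply measure_mono
          rintro x ⟨k, a, b, e⟩
          exact (pow_le_pow_left₀ hε.le e 4).trans (bG k a b x)
      _ = ENNReal.ofReal (muI.real {x | ε ^ 4 ≤ G x}) := by
          rw [Measure.real, ENNReal.ofReal_toReal (measure_ne_top _ _)]
      _ ≤ _ := by
          apply ENNReal.ofReal_le_ofReal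
          rw [le_div_iff₀ (by positivity), mul_comm]
          refine hmk.trans (iG.trans ?_)
          have : (∑ k ∈ Finset.Ico n j, w k) ^ 2 ≤ tl n ^ 2 :=
            pow_le_pow_left₀ (Finset.sum_nonneg fun k _ => hw k) (hg n j) 2
          have R0 : 0 ≤ 4000 * R := by linarith
          exact mul_le_mul_of_nonneg_left this R0
  have hae : ∀ ε : ℝ, 0 < ε → ∀ᵐ x ∂muI, ∃ n, ∀ k, n ≤ k →
      ‖∑ r ∈ Finset.Ico n k, u r x‖ < ε := by
    intro ε hε
    rw [ae_iff]
    have hlim : Tendsto (fun n => ENNReal.ofReal (4000 * R * (tl n) ^ 2 / ε ^ 4)) atTop (𝓝 0) := by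
      rw [← ENNReal.ofReal_zero]
      apply ENNReal.tendsto_ofReal
      have := ((htl0.pow 2).const_mul (4000 * R)).div_const (ε ^ 4)
      simpa using this
    refine le_antisymm (ge_of_tendsto' hlim fun n => ?_) zero_le
    refine (measure_mono ?_).trans (hbad ε hε n)
    intro x hx
    simp only [Set.mem_ofPred_eq, not_exists, not_forall, not_lt] at hx ⊢
    obtain ⟨k, a, b⟩ := hx n
    exact ⟨k, a, b⟩
  have hall : ∀ᵐ x ∂muI, ∀ q : ℕ, ∃ n, ∀ k, n ≤ k →
      ‖∑ r ∈ Finset.Ico n k, u r x‖ < 1 / ((q : ℝ) + 1) :=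
    ae_all_iff.2 fun q => hae _ (by positivity)
  filter_upwards [hall] with x hx
  apply cauchySeq_tendsto_of_complete
  rw [Metric.cauchySeq_iff']
  intro ε hε
  obtain ⟨q, hq⟩ := exists_nat_one_div_lt hε
  obtain ⟨n, hn⟩ := hx q
  refine ⟨n, fun k hk => ?_⟩
  rw [dist_eq_norm, ← Finset.sum_Ico_eq_sub _ hk]
  exact (hn k hk).trans hq

lemma summable_of_conv (u : ℕ → ℝ → ℂ) (hu : ∀ k, Continuous (u k)) (w : ℕ → ℝ)
    (hw : ∀ k, 0 ≤ w k) (R : ℝ) (hR : 1 ≤ R)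
    (hL : ∀ N, ∫ x, ‖∑ k ∈ Finset.range N, u k x‖ ^ 4 ∂muI ≤ R * (∑ k ∈ Finset.range N, w k) ^ 2)
    (hL2 : ∀ N, ∫ x, ‖∑ k ∈ Finset.range N, u k x‖ ^ 2 ∂muI = ∑ k ∈ Finset.range N, w k)
    (hc : ∀ᵐ x ∂muI, ∃ L : ℂ, Tendsto (fun N => ∑ k ∈ Finset.range N, u k x) atTop (𝓝 L)) :
    Summable w := by
  have R0 : 0 < R := by linarith
  set S : ℕ → ℝ → ℂ := fun N x => ∑ k ∈ Finset.range N, u k x with hS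
  have cS : ∀ N, Continuous (S N) := fun N => by simp only [hS]; fun_prop
  set B : ℕ → Set ℝ := fun M => {x | ∀ N, ‖S N x‖ ≤ M}ᶜ with hB
  have mB : ∀ M, MeasurableSet (B M) := by
    intro M
    apply MeasurableSet.compl
    simp only [Set.ofPred_forall]
    exact MeasurableSet.iInter fun N => (isClosed_le (cS N).norm continuous_const).measurableSet
  have hanti : Antitone B := by
    intro M M' h x hx hx'
    exact hx fun N => (hx' N).trans (by exact_mod_cast h)
  have hlim := tendsto_measure_iInter_atTop (μ := muI) (s := B)
    (fun M => (mB M).nullMeasurableSet) hanti ⟨0, measure_ne_top _ _⟩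
  have hz : muI (⋂ M, B M) = 0 := by
    rw [← nonpos_iff_eq_zero, ← ae_iff.1 hc]
    apply measure_mono
    intro x hx
    simp only [Set.mem_ofPred_eq]
    rintro ⟨L, hLx⟩
    obtain ⟨b, hb⟩ := hLx.norm.bddAbove_range
    obtain ⟨M, hM⟩ := exists_nat_ge b
    exact Set.mem_iInter.1 hx M fun N => (hb ⟨N, rfl⟩).trans hM
  rw [hz] at hlim
  have hpos : (0 : ENNReal) < ENNReal.ofReal (1 / (4 * R)) := by
    rw [ENNReal.ofReal_pos]; positivity
  obtain ⟨M, hM⟩ := (hlim.eventually (gt_mem_nhds hpos)).exists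
  have hM' : muI.real (B M) ≤ 1 / (4 * R) := by
    rw [Measure.real]
    exact ENNReal.toReal_le_of_le_ofReal (by positivity) hM.le
  refine summable_of_sum_range_le (c := 2 * (M : ℝ) ^ 2) hw fun N => ?_
  set σ := ∑ k ∈ Finset.range N, w k with hσ
  have σ0 : 0 ≤ σ := Finset.sum_nonneg fun k _ => hw k
  rcases σ0.eq_or_lt with h0 | hpσ
  · rw [← h0]; positivity
  have hpt : ∀ x, ‖S N x‖ ^ 2 ≤ (M : ℝ) ^ 2 + (B M).indicator (fun _ => R * σ) x
      + 1 / (4 * R * σ) * ‖S N x‖ ^ 4 := by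
    intro x
    have hp4 : 0 ≤ 1 / (4 * R * σ) * ‖S N x‖ ^ 4 := by positivity
    by_cases hx : x ∈ B M
    · rw [Set.indicator_of_mem hx]
      have : ‖S N x‖ ^ 2 ≤ R * σ + 1 / (4 * R * σ) * ‖S N x‖ ^ 4 := by
        rw [← sub_nonneg]
        have : R * σ + 1 / (4 * R * σ) * ‖S N x‖ ^ 4 - ‖S N x‖ ^ 2
            = (2 * (R * σ) - ‖S N x‖ ^ 2) ^ 2 / (4 * R * σ) := by
          field_simp; ring
        rw [this]; positivity
      nlinarith [sq_nonneg (M : ℝ)]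
    · rw [Set.indicator_of_notMem hx]
      have hx' : ∀ N, ‖S N x‖ ≤ M := by simpa [hB] using hx
      have := pow_le_pow_left₀ (norm_nonneg _) (hx' N) 2
      linarith
  have i2 : Integrable (fun x => ‖S N x‖ ^ 2) muI := integrable_muI ((cS N).norm.pow 2)
  have i4 : Integrable (fun x => ‖S N x‖ ^ 4) muI := integrable_muI ((cS N).norm.pow 4)
  have iB : Integrable ((B M).indicator (fun _ => R * σ)) muI :=
    (integrable_const _).indicator (mB M)
  have iC : Integrable (fun x => (M:ℝ)^2 + (B M).indicator (fun _ => R * σ) x) muI :=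
    (integrable_const ((M:ℝ)^2)).add iB
  have hI := integral_mono i2 (iC.add (i4.const_mul _)) hpt
  simp only [Pi.add_apply] at hI
  rw [integral_add iC (i4.const_mul _),
    integral_add (integrable_const _) iB, integral_const_mul, hL2 N,
    integral_indicator_const _ (mB M)] at hI
  simp only [integral_const, probReal_univ, smul_eq_mul, one_mul] at hI
  have t1 : muI.real (B M) * (R * σ) ≤ σ / 4 := by
    calc _ ≤ 1 / (4 * R) * (R * σ) := by gcongr
      _ = σ / 4 := by field_simp
  have t2 : 1 / (4 * R * σ) * ∫ x, ‖S N x‖ ^ 4 ∂muI ≤ σ / 4 := by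
    calc _ ≤ 1 / (4 * R * σ) * (R * σ ^ 2) := by gcongr; exact hL N
      _ = σ / 4 := by field_simp
  linarith

/-- **Corollary 4.** Let `l ≥ 2` and let `{m_k}` be a (not necessarily increasing)
enumeration of `D*(l)`. Then `∑_k c_k e^{2πi m_k x}` converges for almost every `x ∈ (0,1)`
if and only if `∑_k |c_k|² < ∞`. -/
theorem statement9 (l : ℕ) (hl : 2 ≤ l)
    (m : ℕ → ℕ) (hminj : Function.Injective m) (hmr : Set.range m = DyadicStar l)
    (c : ℕ → ℂ) :
    (∀ᵐ x ∂(volume.restrict (Set.Ioo (0:ℝ) 1)),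
      ∃ L : ℂ, Tendsto (fun N => ∑ k ∈ Finset.range N, c k * expi (m k) x) atTop (𝓝 L)) ↔
    Summable (fun k => ‖c k‖ ^ 2) := by
  obtain ⟨R, hR, hL⟩ := L4_bound l
  have hm : ∀ k, m k ∈ DyadicStar l := fun k => hmr ▸ Set.mem_range_self k
  have hu : ∀ k, Continuous fun x => c k * expi (m k) x := fun k =>
    (continuous_expi _).const_mul _
  constructor
  · exact summable_of_conv (fun k x => c k * expi (m k) x) hu (fun k => ‖c k‖ ^ 2)
      (fun k => by positivity) R hR (fun N => hL m hminj hm c _)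
      (fun N => parseval _ m hminj.injOn c)
  · exact conv_of_summable (fun k x => c k * expi (m k) x) hu (fun k => ‖c k‖ ^ 2)
      (fun k => by positivity) R hR (fun i j => hL m hminj hm c _)
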